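/- arXiv:1711.04747 — 3 statements merged into one kernel-verified Lean document; each statement's English description precedes it below -/
import Mathlib

section
/- Let λ = (λ_n)_{n≥0} be a sequence of elements of K with λ_n ≠ 0 for all n. Then the matrix ansatz system for λ has at most one solution: if g₁ and g₂ are both solutions of the matrix ansatz system for λ, then g₁ = g₂. -/
open MvPolynomial Finset

noncomputable section

/-- The polynomial ring `ℚ[α,β,γ,δ,q,u]`: variables `0,1,2,3,4,5` are `α,β,γ,δ,q,u`. -/
abbrev P6 : Type := MvPolynomial (Fin 6) ℚ

/-- The field of rational functions `ℚ(α,β,γ,δ,q,u)`. -/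
abbrev K6 : Type := FractionRing P6

def va : K6 := algebraMap P6 K6 (X 0)  -- α
def vb : K6 := algebraMap P6 K6 (X 1)  -- β
def vg : K6 := algebraMap P6 K6 (X 2)  -- γ
def vd : K6 := algebraMap P6 K6 (X 3)  -- δ
def vq : K6 := algebraMap P6 K6 (X 4)  -- q
def vu : K6 := algebraMap P6 K6 (X 5)  -- u

/-- Words over `{•,∘}` are lists of booleans, `true` = `•` and `false` = `∘`;
the head of the list is the leftmost letter of the word. -/
def IsSolution (lam : ℕ → K6) (g : List Bool → K6) : Prop :=
  (∀ Xl Yl : List Bool,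
      vu * g (Xl ++ true :: false :: Yl) =
        vq * g (Xl ++ false :: true :: Yl) +
          lam (Xl.length + Yl.length + 2) * (g (Xl ++ true :: Yl) + g (Xl ++ false :: Yl))) ∧
  (∀ Xl : List Bool, va * g (false :: Xl) = vg * g (true :: Xl) + lam (Xl.length + 1) * g Xl) ∧
  (∀ Xl : List Bool, vb * g (Xl ++ [true]) = vd * g (Xl ++ [false]) + lam (Xl.length + 1) * g Xl) ∧
  g [] = lam 0

/-- `Σ_{X = U•V} u^{n−1−|∘(U)|−|V|} q^{|∘(U)|+|V|} (g(U•V)+g(U∘V))`, the sum being over all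
decompositions of `X` as a concatenation `U•V`. -/
def sumBlack (g : List Bool → K6) (Xl : List Bool) : K6 :=
  ∑ i : Fin Xl.length,
    if Xl.get i = true then
      vu ^ (Xl.length - 1 - (Xl.take i.val).count false - (Xl.drop (i.val + 1)).length) *
        vq ^ ((Xl.take i.val).count false + (Xl.drop (i.val + 1)).length) *
        (g (Xl.take i.val ++ true :: Xl.drop (i.val + 1)) +
          g (Xl.take i.val ++ false :: Xl.drop (i.val + 1)))
    else 0

/-- `Σ_{X = U∘V} u^{n−1−|∘(U)|} q^{|∘(U)|} (g(U•V)+g(U∘V))`, the sum being over all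
decompositions of `X` as a concatenation `U∘V`. -/
def sumWhite (g : List Bool → K6) (Xl : List Bool) : K6 :=
  ∑ i : Fin Xl.length,
    if Xl.get i = false then
      vu ^ (Xl.length - 1 - (Xl.take i.val).count false) *
        vq ^ ((Xl.take i.val).count false) *
        (g (Xl.take i.val ++ true :: Xl.drop (i.val + 1)) +
          g (Xl.take i.val ++ false :: Xl.drop (i.val + 1)))
    else 0

/-- The global recurrence (2.2), computing `h(•X)`. -/
def GlobalRecBlack (lam : ℕ → K6) (h : List Bool → K6) : Prop :=
  ∀ Xl : List Bool,
    h (true :: Xl) =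
      lam (Xl.length + 1) / (vu ^ Xl.length * va * vb - vq ^ Xl.length * vg * vd) *
        (va * vd * sumBlack h Xl + vq ^ Xl.length * vd * h Xl +
          vu ^ (Xl.length - Xl.count false) * vq ^ (Xl.count false) * va * h Xl +
          va * vb * sumWhite h Xl)

/-- The global recurrence (2.3), computing `h(∘X)`. -/
def GlobalRecWhite (lam : ℕ → K6) (h : List Bool → K6) : Prop :=
  ∀ Xl : List Bool,
    h (false :: Xl) =
      lam (Xl.length + 1) / (vu ^ Xl.length * va * vb - vq ^ Xl.length * vg * vd) *
        (vg * vd * sumBlack h Xl +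
          vu ^ (Xl.length - Xl.count false) * vq ^ (Xl.count false) * vg * h Xl +
          vg * vb * sumWhite h Xl + vu ^ Xl.length * vb * h Xl)

section Homogeneous

variable {F : Type*} [Field F] {u q a b c e : F} {N : ℕ} {d : List Bool → F}

/-- Moving a `•` to the right end of a word, under the homogeneous exchange relation. -/
lemma black_shift
    (h : ∀ Z Y : List Bool, Z.length + Y.length + 2 = N →
      u * d (Z ++ true :: false :: Y) = q * d (Z ++ false :: true :: Y))
    (Y Z : List Bool) (hN : Z.length + Y.length + 1 = N) :
    u ^ Y.count false * d (Z ++ true :: Y) = q ^ Y.count false * d (Z ++ Y ++ [true]) := by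
  induction Y generalizing Z with
  | nil => simp
  | cons y Y ih =>
    simp only [List.length_cons] at hN
    have hs := ih (Z ++ [y]) (by simp only [List.length_append, List.length_singleton]; omega)
    simp only [List.append_assoc, List.cons_append, List.nil_append] at hs ⊢
    cases y with
    | true => simpa using hs
    | false =>
      have hx := h Z Y (by omega)
      simp only [List.count_cons_self, pow_succ]
      linear_combination u ^ Y.count false * hx + q * hs

/-- Moving a `∘` to the left end of a word, under the homogeneous exchange relation. -/
lemma white_shift
    (h : ∀ Z Y : List Bool, Z.length + Y.length + 2 = N →
      u * d (Z ++ true :: false :: Y) = q * d (Z ++ false :: true :: Y))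
    (Y Z : List Bool) (hN : Z.length + Y.length + 1 = N) :
    u ^ Y.count true * d (Z ++ Y ++ [false]) = q ^ Y.count true * d (Z ++ false :: Y) := by
  induction Y generalizing Z with
  | nil => simp
  | cons y Y ih =>
    simp only [List.length_cons] at hN
    have hs := ih (Z ++ [y]) (by simp only [List.length_append, List.length_singleton]; omega)
    simp only [List.append_assoc, List.cons_append, List.nil_append] at hs ⊢
    cases y with
    | false => simpa using hs
    | true =>
      have hx := h Z Y (by omega)
      simp only [List.count_cons_self, pow_succ]
      linear_combination q ^ Y.count true * hx + u * hs

/-- The homogeneous system on words of length `n + 1` has only the zero solution as soon as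
`uⁿab - qⁿce` does not vanish. -/
lemma homogeneous_eq_zero {n : ℕ} (ha : a ≠ 0) (hD : u ^ n * a * b - q ^ n * c * e ≠ 0)
    (h : ∀ Z Y : List Bool, Z.length + Y.length + 2 = n + 1 →
      u * d (Z ++ true :: false :: Y) = q * d (Z ++ false :: true :: Y))
    (hl : ∀ Y : List Bool, Y.length = n → a * d (false :: Y) = c * d (true :: Y))
    (hr : ∀ Y : List Bool, Y.length = n → b * d (Y ++ [true]) = e * d (Y ++ [false]))
    (W : List Bool) (hW : W.length = n + 1) : d W = 0 := by
  obtain _ | ⟨w, Y⟩ := W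
  · simp at hW
  have hY : Y.length = n := by simpa using hW
  have hb := black_shift h Y [] (by simp [hY])
  have hw := white_shift h Y [] (by simp [hY])
  simp only [List.nil_append] at hb hw
  have hn : n = Y.count false + Y.count true := by
    rw [← hY, Nat.add_comm]; exact (List.count_true_add_count_false Y).symm
  have hblack : d (true :: Y) = 0 := by
    refine (mul_eq_zero.mp ?_).resolve_left hD
    rw [hn, pow_add, pow_add]
    linear_combination u ^ Y.count true * a * b * hb +
      u ^ Y.count true * q ^ Y.count false * a * hr Y hY +
      q ^ Y.count false * a * e * hw +
      q ^ Y.count false * q ^ Y.count true * e * hl Y hY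
  cases w with
  | true => exact hblack
  | false =>
    refine (mul_eq_zero.mp ?_).resolve_left ha
    rw [hl Y hY, hblack, mul_zero]

end Homogeneous

lemma va_ne_zero : va ≠ 0 := by
  rw [va, Ne, IsFractionRing.to_map_eq_zero_iff]
  exact X_ne_zero 0

lemma denominator_ne_zero (n : ℕ) : vu ^ n * va * vb - vq ^ n * vg * vd ≠ 0 := by
  have hP : (X 5 ^ n * X 0 * X 1 - X 4 ^ n * X 2 * X 3 : P6) ≠ 0 := by
    intro hzero
    have := congrArg (eval (![1, 1, 0, 0, 0, 1] : Fin 6 → ℚ)) hzero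
    simp at this
  simp only [va, vb, vg, vd, vq, vu, ← map_pow, ← map_mul, ← map_sub]
  rwa [Ne, IsFractionRing.to_map_eq_zero_iff]

/-- if `λ_n ≠ 0` for all `n`, the matrix ansatz system for `λ` has at most one
solution. -/
theorem statement3 (lam : ℕ → K6) (hlam : ∀ n, lam n ≠ 0) (g₁ g₂ : List Bool → K6)
    (h₁ : IsSolution lam g₁) (h₂ : IsSolution lam g₂) : g₁ = g₂ := by
  suffices ∀ (n : ℕ) (W : List Bool), W.length = n → g₁ W - g₂ W = 0 from
    funext fun W => sub_eq_zero.mp (this _ W rfl)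
  obtain ⟨hx₁, hl₁, hr₁, he₁⟩ := h₁
  obtain ⟨hx₂, hl₂, hr₂, he₂⟩ := h₂
  intro n
  induction n with
  | zero =>
    intro W hW
    rw [List.eq_nil_of_length_eq_zero hW, he₁, he₂, sub_self]
  | succ n ih =>
    refine homogeneous_eq_zero (d := fun W => g₁ W - g₂ W) va_ne_zero (denominator_ne_zero n)
      (fun Z Y hn => ?_) (fun Y hn => ?_) (fun Y hn => ?_)
    · have ht := ih (Z ++ true :: Y) (by simp only [List.length_append, List.length_cons]; omega)
      have hf := ih (Z ++ false :: Y) (by simp only [List.length_append, List.length_cons]; omega)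
      linear_combination hx₁ Z Y - hx₂ Z Y + lam (Z.length + Y.length + 2) * (ht + hf)
    · linear_combination hl₁ Y - hl₂ Y + lam (Y.length + 1) * ih Y hn
    · linear_combination hr₁ Y - hr₂ Y + lam (Y.length + 1) * ih Y hn
end
end

section
/- The composition of w with the canonical embedding of ℚ[α,β,γ,δ,q,u] into K is a solution of the matrix ansatz system for the sequence λ given by λ_0 = 1 and λ_n = u^{n−1}·α·β − q^{n−1}·γ·δ for all n ≥ 1. -/
open MvPolynomial Finset

noncomputable section

/-- `Σ_{X = U•V} u^{n−1−|∘(U)|−|V|} q^{|∘(U)|+|V|} (g(U•V)+g(U∘V))` in `ℚ[α,β,γ,δ,q,u]`. -/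
def sumBlackP (g : List Bool → P6) (Xl : List Bool) : P6 :=
  ∑ i : Fin Xl.length,
    if Xl.get i = true then
      (X 5 : P6) ^ (Xl.length - 1 - (Xl.take i.val).count false - (Xl.drop (i.val + 1)).length) *
        (X 4 : P6) ^ ((Xl.take i.val).count false + (Xl.drop (i.val + 1)).length) *
        (g (Xl.take i.val ++ true :: Xl.drop (i.val + 1)) +
          g (Xl.take i.val ++ false :: Xl.drop (i.val + 1)))
    else 0

/-- `Σ_{X = U∘V} u^{n−1−|∘(U)|} q^{|∘(U)|} (g(U•V)+g(U∘V))` in `ℚ[α,β,γ,δ,q,u]`. -/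
def sumWhiteP (g : List Bool → P6) (Xl : List Bool) : P6 :=
  ∑ i : Fin Xl.length,
    if Xl.get i = false then
      (X 5 : P6) ^ (Xl.length - 1 - (Xl.take i.val).count false) *
        (X 4 : P6) ^ ((Xl.take i.val).count false) *
        (g (Xl.take i.val ++ true :: Xl.drop (i.val + 1)) +
          g (Xl.take i.val ++ false :: Xl.drop (i.val + 1)))
    else 0

/-- Auxiliary function computing `w` for words of length at most the first argument. -/
def wAux : ℕ → List Bool → P6
  | 0, _ => 1
  | _ + 1, [] => 1
  | n + 1, b :: Yl =>
    if b then
      -- w(•X)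
      X 0 * X 3 * sumBlackP (wAux n) Yl + (X 4 : P6) ^ Yl.length * X 3 * wAux n Yl +
        (X 5 : P6) ^ (Yl.length - Yl.count false) * (X 4 : P6) ^ (Yl.count false) * X 0 *
          wAux n Yl +
        X 0 * X 1 * sumWhiteP (wAux n) Yl
    else
      -- w(∘X)
      X 2 * X 3 * sumBlackP (wAux n) Yl +
        (X 5 : P6) ^ (Yl.length - Yl.count false) * (X 4 : P6) ^ (Yl.count false) * X 2 *
          wAux n Yl +
        X 2 * X 1 * sumWhiteP (wAux n) Yl + (X 5 : P6) ^ Yl.length * X 1 * wAux n Yl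

/-- The weight `w(m) ∈ ℚ[α,β,γ,δ,q,u]` of a word `m` over `{•,∘}` (`true` = `•`,
head of the list = leftmost letter), defined by `w(ε) = 1` and the recurrences (2.2), (2.3)
specialised to `λ_{n+1} = u^n αβ − q^n γδ` (which cancels the denominator). -/
def w (m : List Bool) : P6 := wAux m.length m

/-- The sequence `λ₀ = 1`, `λ_n = u^{n−1} αβ − q^{n−1} γδ` for `n ≥ 1`, viewed in `K6`. -/
def lamStd : ℕ → K6
  | 0 => 1
  | n + 1 => algebraMap P6 K6 ((X 5 : P6) ^ n * X 0 * X 1 - (X 4 : P6) ^ n * X 2 * X 3)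

section Words

variable {R : Type*} [CommRing R]

/-- The multiplicative weight `u^{|•(X)|} q^{|∘(X)|}` of a word `X`. -/
def wordWeight (q u : R) : List Bool → R
  | [] => 1
  | x :: Y => (if x then u else q) * wordWeight q u Y

/-- `Σ_{X = U t V} u^{|•(U)|} q^{|∘(U)|} r^{|V|} F(U, V)`, the sum being over all occurrences of
the letter `t` in `X`. -/
def occSum (q u : R) (t : Bool) (r : R) : (List Bool → List Bool → R) → List Bool → R
  | _, [] => 0
  | F, x :: Y =>
    (if x = t then r ^ Y.length * F [] Y else 0) +
      (if x then u else q) * occSum q u t r (fun U V => F (x :: U) V) Y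

/-- The sum of `f` over the two words obtained by filling the gap between `U` and `V`. -/
def fillSum (f : List Bool → R) (U V : List Bool) : R :=
  f (U ++ true :: V) + f (U ++ false :: V)

lemma wordWeight_append (q u : R) (X Y : List Bool) :
    wordWeight q u (X ++ Y) = wordWeight q u X * wordWeight q u Y := by
  induction X with
  | nil => simp [wordWeight]
  | cons x X ih => simp only [List.cons_append, wordWeight, ih]; ring

lemma wordWeight_eq (q u : R) (X : List Bool) :
    wordWeight q u X = u ^ (X.length - X.count false) * q ^ X.count false := by
  induction X with
  | nil => simp [wordWeight]
  | cons x X ih =>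
    have h := List.count_le_length (a := false) (l := X)
    cases x
    · simp [wordWeight, ih]; ring
    · have e : X.length + 1 - X.count false = (X.length - X.count false) + 1 := by omega
      simp [wordWeight, ih, e]; ring

lemma wordWeight_ne_zero [IsDomain R] {q u : R} (hq : q ≠ 0) (hu : u ≠ 0) (X : List Bool) :
    wordWeight q u X ≠ 0 := by
  induction X with
  | nil => simp [wordWeight]
  | cons x X ih => cases x <;> simp [wordWeight, ih, hq, hu]

lemma occSum_congr (q u : R) (t : Bool) (r : R) {F G : List Bool → List Bool → R} (X : List Bool)
    (h : ∀ U V : List Bool, U.length + V.length + 1 = X.length → F U V = G U V) :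
    occSum q u t r F X = occSum q u t r G X := by
  induction X generalizing F G with
  | nil => rfl
  | cons x X ih =>
    have h0 : F [] X = G [] X := h _ _ (by simp)
    have h1 := ih (F := fun U V => F (x :: U) V) (G := fun U V => G (x :: U) V)
      (fun U V hUV => h _ _ (by simp only [List.length_cons]; omega))
    simp only [occSum, h0, h1]

lemma occSum_linear (q u : R) (t : Bool) (r : R) (a b : R) (F G : List Bool → List Bool → R)
    (X : List Bool) :
    occSum q u t r (fun U V => a * F U V + b * G U V) X =
      a * occSum q u t r F X + b * occSum q u t r G X := by
  induction X generalizing F G with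
  | nil => simp [occSum]
  | cons x X ih =>
    have h := ih (fun U V => F (x :: U) V) (fun U V => G (x :: U) V)
    simp only [occSum, h]
    split_ifs <;> ring

lemma occSum_append (q u : R) (t : Bool) (r : R) (F : List Bool → List Bool → R)
    (X Y : List Bool) :
    occSum q u t r F (X ++ Y) =
      r ^ Y.length * occSum q u t r (fun U V => F U (V ++ Y)) X +
        wordWeight q u X * occSum q u t r (fun U V => F (X ++ U) V) Y := by
  induction X generalizing F with
  | nil => simp [occSum, wordWeight]
  | cons x X ih =>
    have h := ih (fun U V => F (x :: U) V)
    simp only [List.cons_append, occSum, wordWeight, h, List.length_append]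
    split_ifs <;> ring

lemma occSum_eq_sum (q u : R) (t : Bool) (r : R) (F : List Bool → List Bool → R)
    (X : List Bool) :
    occSum q u t r F X = ∑ i : Fin X.length,
      if X.get i = t then
        wordWeight q u (X.take i.val) * r ^ (X.drop (i.val + 1)).length *
          F (X.take i.val) (X.drop (i.val + 1))
      else 0 := by
  induction X generalizing F with
  | nil => simp [occSum]
  | cons x X ih =>
    rw [occSum, ih]
    refine Eq.trans ?_ (Fin.sum_univ_succ (n := X.length) _).symm
    rw [mul_sum]
    congr 1
    · simp [wordWeight]
    · refine sum_congr rfl fun i _ => ?_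
      simp only [mul_ite, mul_zero, List.get_eq_getElem, Fin.val_succ, List.getElem_cons_succ,
        List.take_succ_cons, List.drop_succ_cons, wordWeight, mul_assoc]

/-- The exchange relation of the matrix ansatz with parameter `l`, for words of length `n`. -/
def ExchangeAt (q u l : R) (f : List Bool → R) (n : ℕ) : Prop :=
  ∀ X Y : List Bool, X.length + Y.length + 2 = n →
    u * f (X ++ true :: false :: Y) = q * f (X ++ false :: true :: Y) + l * fillSum f X Y

/-- Moving a `•` to the right end of a word. -/
lemma ExchangeAt.move_black {q u l : R} {f : List Bool → R} {n : ℕ} (h : ExchangeAt q u l f n)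
    (P Y : List Bool) (hn : P.length + Y.length + 1 = n) :
    u ^ Y.length * f (P ++ true :: Y) = wordWeight q u Y * f (P ++ Y ++ [true]) +
      l * occSum q u false u (fun U V => fillSum f (P ++ U) V) Y := by
  induction Y generalizing P with
  | nil => simp [wordWeight, occSum]
  | cons y Y ih =>
    simp only [List.length_cons] at hn
    have h1 := ih (P ++ [y]) (by simp; omega)
    simp only [List.append_assoc, List.cons_append, List.nil_append] at h1
    cases y
    · have h2 := h P Y (by omega)
      simp [wordWeight, occSum]
      linear_combination q * h1 + u ^ Y.length * h2
    · simp [wordWeight, occSum]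
      linear_combination u * h1

/-- Moving a `∘` to the right end of a word. -/
lemma ExchangeAt.move_white {q u l : R} {f : List Bool → R} {n : ℕ} (h : ExchangeAt q u l f n)
    (P Y : List Bool) (hn : P.length + Y.length + 1 = n) :
    q ^ Y.length * f (P ++ false :: Y) = wordWeight q u Y * f (P ++ Y ++ [false]) -
      l * occSum q u true q (fun U V => fillSum f (P ++ U) V) Y := by
  induction Y generalizing P with
  | nil => simp [wordWeight, occSum]
  | cons y Y ih =>
    simp only [List.length_cons] at hn
    have h1 := ih (P ++ [y]) (by simp; omega)
    simp only [List.append_assoc, List.cons_append, List.nil_append] at h1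
    cases y
    · simp [wordWeight, occSum]
      linear_combination q * h1
    · have h2 := h P Y (by omega)
      simp [wordWeight, occSum]
      linear_combination u * h1 - q ^ Y.length * h2

/-- A function on words satisfying the recurrences defining `w`, over an arbitrary commutative
ring. -/
structure WordRec (a b c d q u : R) (f : List Bool → R) : Prop where
  black : ∀ X : List Bool, f (true :: X) =
    a * d * occSum q u true q (fillSum f) X + q ^ X.length * d * f X +
      wordWeight q u X * a * f X + a * b * occSum q u false u (fillSum f) X
  white : ∀ X : List Bool, f (false :: X) =
    c * d * occSum q u true q (fillSum f) X + wordWeight q u X * c * f X +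
      c * b * occSum q u false u (fillSum f) X + u ^ X.length * b * f X

namespace WordRec

variable {a b c d q u : R} {f : List Bool → R}

lemma left_boundary (h : WordRec a b c d q u f) (X : List Bool) :
    a * f (false :: X) = c * f (true :: X) +
      (u ^ X.length * a * b - q ^ X.length * c * d) * f X := by
  rw [h.black, h.white]; ring

lemma conjugate_boundary (h : WordRec a b c d q u f) (X : List Bool) :
    u ^ X.length * b * f (true :: X) - q ^ X.length * d * f (false :: X) =
      (u ^ X.length * a * b - q ^ X.length * c * d) *
        (wordWeight q u X * f X + b * occSum q u false u (fillSum f) X +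
          d * occSum q u true q (fillSum f) X) := by
  rw [h.black, h.white]; ring

lemma right_boundary [IsDomain R] (h : WordRec a b c d q u f) (hq : q ≠ 0) (hu : u ≠ 0)
    (X : List Bool)
    (hX : ExchangeAt q u (u ^ X.length * a * b - q ^ X.length * c * d) f (X.length + 1)) :
    b * f (X ++ [true]) = d * f (X ++ [false]) +
      (u ^ X.length * a * b - q ^ X.length * c * d) * f X := by
  have h1 := hX.move_black [] X (by simp)
  have h2 := hX.move_white [] X (by simp)
  have h3 := h.conjugate_boundary X
  simp only [List.nil_append] at h1 h2
  apply mul_left_cancel₀ (wordWeight_ne_zero hq hu X)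
  linear_combination h3 - b * h1 + d * h2

lemma exchange_nil (h : WordRec a b c d q u f) (Y : List Bool) :
    u * f (true :: false :: Y) = q * f (false :: true :: Y) +
      (u ^ (Y.length + 1) * a * b - q ^ (Y.length + 1) * c * d) * fillSum f [] Y := by
  have key : ∀ (t : Bool) (r : R),
      a * occSum q u t r (fun U V => fillSum f (false :: U) V) Y =
        c * occSum q u t r (fun U V => fillSum f (true :: U) V) Y +
          (u ^ Y.length * a * b - q ^ Y.length * c * d) * occSum q u t r (fillSum f) Y := by
    intro t r
    have e1 := occSum_linear q u t r a (-c) (fun U V => fillSum f (false :: U) V)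
      (fun U V => fillSum f (true :: U) V) Y
    have e2 := occSum_linear q u t r (u ^ Y.length * a * b - q ^ Y.length * c * d) 0
      (fillSum f) (fillSum f) Y
    have e3 := occSum_congr q u t r
      (F := fun U V => a * fillSum f (false :: U) V + -c * fillSum f (true :: U) V)
      (G := fun U V => (u ^ Y.length * a * b - q ^ Y.length * c * d) * fillSum f U V +
        0 * fillSum f U V) Y (by
        intro U V hUV
        have g1 := h.left_boundary (U ++ true :: V)
        have g2 := h.left_boundary (U ++ false :: V)
        have hl : ∀ x, (U ++ x :: V).length = Y.length := by intro x; simp; omega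
        rw [hl] at g1 g2
        simp only [fillSum, List.cons_append]
        linear_combination g1 + g2)
    linear_combination e2 + e3 - e1
  have kB := key true q
  have kW := key false u
  have h1 := h.conjugate_boundary Y
  have h2 := h.left_boundary Y
  rw [h.black (false :: Y), h.white (true :: Y)]
  simp [occSum, wordWeight]
  linear_combination u * q * d * kB + u * q * b * kW - u * q * h1 +
    u * q * wordWeight q u Y * h2

lemma exchange_black [IsDomain R] (h : WordRec a b c d q u f) (hq : q ≠ 0) (hu : u ≠ 0)
    (X Y : List Bool)
    (hn : ExchangeAt q u (u ^ (X.length + Y.length + 1) * a * b -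
      q ^ (X.length + Y.length + 1) * c * d) f (X.length + Y.length + 2)) :
    u * f (true :: (X ++ true :: false :: Y)) = q * f (true :: (X ++ false :: true :: Y)) +
      (u ^ (X.length + Y.length + 2) * a * b - q ^ (X.length + Y.length + 2) * c * d) *
        (f (true :: (X ++ true :: Y)) + f (true :: (X ++ false :: Y))) := by
  have hl : ∀ x, (X ++ x :: Y).length = X.length + Y.length + 1 := by intro x; simp; omega
  have hl2 : ∀ x y, (X ++ x :: y :: Y).length = X.length + Y.length + 2 := by
    intro x y; simp; omega
  set l := u ^ (X.length + Y.length + 1) * a * b - q ^ (X.length + Y.length + 1) * c * d with hldef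
  -- the parts of the sums coming from letters of `X`
  have partX : ∀ (t : Bool) (r : R),
      u * occSum q u t r (fun U V => fillSum f U (V ++ true :: false :: Y)) X =
        q * occSum q u t r (fun U V => fillSum f U (V ++ false :: true :: Y)) X +
          l * (occSum q u t r (fun U V => fillSum f U (V ++ true :: Y)) X +
            occSum q u t r (fun U V => fillSum f U (V ++ false :: Y)) X) := by
    intro t r
    have e1 := occSum_linear q u t r u (-q) (fun U V => fillSum f U (V ++ true :: false :: Y))
      (fun U V => fillSum f U (V ++ false :: true :: Y)) X
    have e2 := occSum_linear q u t r l l (fun U V => fillSum f U (V ++ true :: Y))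
      (fun U V => fillSum f U (V ++ false :: Y)) X
    have e3 := occSum_congr q u t r
      (F := fun U V => u * fillSum f U (V ++ true :: false :: Y) +
        -q * fillSum f U (V ++ false :: true :: Y))
      (G := fun U V => l * fillSum f U (V ++ true :: Y) + l * fillSum f U (V ++ false :: Y)) X (by
        intro U V hUV
        have g1 := hn (U ++ true :: V) Y (by simp; omega)
        have g2 := hn (U ++ false :: V) Y (by simp; omega)
        simp only [fillSum, List.append_assoc, List.cons_append] at g1 g2 ⊢
        linear_combination g1 + g2)
    linear_combination e2 + e3 - e1
  -- the parts of the sums coming from letters of `Y`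
  have partY : ∀ (t : Bool) (r : R),
      u * occSum q u t r (fun U V => fillSum f (X ++ true :: false :: U) V) Y =
        q * occSum q u t r (fun U V => fillSum f (X ++ false :: true :: U) V) Y +
          l * (occSum q u t r (fun U V => fillSum f (X ++ true :: U) V) Y +
            occSum q u t r (fun U V => fillSum f (X ++ false :: U) V) Y) := by
    intro t r
    have e1 := occSum_linear q u t r u (-q) (fun U V => fillSum f (X ++ true :: false :: U) V)
      (fun U V => fillSum f (X ++ false :: true :: U) V) Y
    have e2 := occSum_linear q u t r l l (fun U V => fillSum f (X ++ true :: U) V)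
      (fun U V => fillSum f (X ++ false :: U) V) Y
    have e3 := occSum_congr q u t r
      (F := fun U V => u * fillSum f (X ++ true :: false :: U) V +
        -q * fillSum f (X ++ false :: true :: U) V)
      (G := fun U V => l * fillSum f (X ++ true :: U) V + l * fillSum f (X ++ false :: U) V) Y (by
        intro U V hUV
        have g1 := hn X (U ++ true :: V) (by simp; omega)
        have g2 := hn X (U ++ false :: V) (by simp; omega)
        simp only [fillSum, List.append_assoc, List.cons_append] at g1 g2 ⊢
        linear_combination g1 + g2)
    linear_combination e2 + e3 - e1
  have hexch := hn X Y rfl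
  -- the sums for the two long words in terms of those for the two short words
  have hB : u * occSum q u true q (fillSum f) (X ++ true :: false :: Y) -
      q * occSum q u true q (fillSum f) (X ++ false :: true :: Y) =
      l * q * (occSum q u true q (fillSum f) (X ++ true :: Y) +
        occSum q u true q (fillSum f) (X ++ false :: Y)) +
      (u - q) * (wordWeight q u X * q * wordWeight q u Y) * f (X ++ false :: Y ++ [false]) := by
    have m := hn.move_white (X ++ [false]) Y (by simp; omega)
    have pX := partX true q
    have pY := partY true q
    simp only [List.append_assoc, List.cons_append, List.nil_append] at m ⊢
    rw [occSum_append, occSum_append, occSum_append, occSum_append]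
    simp [occSum]
    simp only [fillSum, List.append_assoc, List.cons_append, List.nil_append] at hexch pX pY m ⊢
    linear_combination q ^ (Y.length + 2) * pX + wordWeight q u X * u * q * pY +
      wordWeight q u X * q ^ (Y.length + 1) * hexch + wordWeight q u X * q * (u - q) * m
  have hW : u * occSum q u false u (fillSum f) (X ++ true :: false :: Y) -
      q * occSum q u false u (fillSum f) (X ++ false :: true :: Y) =
      l * u * (occSum q u false u (fillSum f) (X ++ true :: Y) +
        occSum q u false u (fillSum f) (X ++ false :: Y)) +
      (u - q) * (wordWeight q u X * u * wordWeight q u Y) * f (X ++ true :: Y ++ [true]) := by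
    have m := hn.move_black (X ++ [true]) Y (by simp; omega)
    have pX := partX false u
    have pY := partY false u
    simp only [List.append_assoc, List.cons_append, List.nil_append] at m ⊢
    rw [occSum_append, occSum_append, occSum_append, occSum_append]
    simp [occSum]
    simp only [fillSum, List.append_assoc, List.cons_append, List.nil_append] at hexch pX pY m ⊢
    linear_combination u ^ (Y.length + 2) * pX + wordWeight q u X * u * q * pY +
      wordWeight q u X * u ^ (Y.length + 1) * hexch + wordWeight q u X * u * (u - q) * m
  have short : ∀ x, (u ^ (X.length + Y.length + 2) * a * b -
      q ^ (X.length + Y.length + 2) * c * d) * f (true :: (X ++ x :: Y)) =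
      q * l * f (true :: (X ++ x :: Y)) + (u - q) * a * b *
        (wordWeight q u (X ++ x :: Y) * f (X ++ x :: Y ++ [true]) +
          l * occSum q u false u (fillSum f) (X ++ x :: Y)) := by
    intro x
    have m := hn.move_black [] (X ++ x :: Y) (by simp; omega)
    rw [hl] at m
    simp only [List.nil_append] at m
    rw [hldef] at m ⊢
    linear_combination (u - q) * a * b * m
  have s1 := short true
  have s2 := short false
  have r2 := h.right_boundary hq hu (X ++ false :: Y) (by rw [hl]; exact hn)
  rw [hl, ← hldef] at r2
  rw [h.black (X ++ true :: Y), hl] at s1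
  rw [h.black (X ++ false :: Y), hl] at s2
  rw [h.black (X ++ true :: false :: Y), h.black (X ++ false :: true :: Y),
    h.black (X ++ true :: Y), h.black (X ++ false :: Y), hl, hl, hl2, hl2]
  simp only [wordWeight_append, wordWeight, if_true, if_false, Bool.false_eq_true] at s1 s2 ⊢
  simp only [fillSum] at hexch
  linear_combination a * d * hB + a * b * hW - s1 - s2 -
    (u - q) * a * (wordWeight q u X * q * wordWeight q u Y) * r2 +
    (q ^ (X.length + Y.length + 2) * d + a * u * q * wordWeight q u X * wordWeight q u Y) * hexch

lemma exchangeAt [IsDomain R] (h : WordRec a b c d q u f) (ha : a ≠ 0) (hq : q ≠ 0) (hu : u ≠ 0)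
    (n : ℕ) : ExchangeAt q u (u ^ n * a * b - q ^ n * c * d) f (n + 1) := by
  induction n with
  | zero => intro X Y hXY; omega
  | succ n ih =>
    intro X Y hXY
    rcases X with _ | ⟨x, X⟩
    · simp only [List.length_nil] at hXY
      obtain rfl : n = Y.length := by omega
      exact h.exchange_nil Y
    · simp only [List.length_cons] at hXY
      obtain rfl : n = X.length + Y.length + 1 := by omega
      have hb := h.exchange_black hq hu X Y ih
      cases x
      · have hexch := ih X Y rfl
        have l1 := h.left_boundary (X ++ true :: false :: Y)
        have l2 := h.left_boundary (X ++ false :: true :: Y)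
        have l3 := h.left_boundary (X ++ true :: Y)
        have l4 := h.left_boundary (X ++ false :: Y)
        have hl : ∀ x, (X ++ x :: Y).length = X.length + Y.length + 1 := by intro x; simp; omega
        have hl2 : ∀ x y, (X ++ x :: y :: Y).length = X.length + Y.length + 2 := by
          intro x y; simp; omega
        rw [hl2] at l1 l2
        rw [hl] at l3 l4
        apply mul_left_cancel₀ ha
        simp only [fillSum, List.cons_append] at hexch ⊢
        linear_combination u * l1 - q * l2 + c * hb +
          (u ^ (X.length + Y.length + 2) * a * b - q ^ (X.length + Y.length + 2) * c * d) *
            (hexch - l3 - l4)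
      · simpa [fillSum] using hb

end WordRec

end Words

lemma sumBlackP_eq_occSum (g : List Bool → P6) (Y : List Bool) :
    sumBlackP g Y = occSum (X 4 : P6) (X 5) true (X 4) (fillSum g) Y := by
  rw [occSum_eq_sum, sumBlackP]
  refine sum_congr rfl fun i _ => ?_
  have hi := i.2
  have e : Y.length - 1 - (Y.take i.val).count false - (Y.drop (i.val + 1)).length =
      (Y.take i.val).length - (Y.take i.val).count false := by
    simp only [List.length_drop, List.length_take]; omega
  rw [e, wordWeight_eq, pow_add, fillSum]
  simp only [mul_assoc]

lemma sumWhiteP_eq_occSum (g : List Bool → P6) (Y : List Bool) :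
    sumWhiteP g Y = occSum (X 4 : P6) (X 5) false (X 5) (fillSum g) Y := by
  rw [occSum_eq_sum, sumWhiteP]
  refine sum_congr rfl fun i _ => ?_
  have hi := i.2
  have hc := List.count_le_length (a := false) (l := Y.take i.val)
  have e : Y.length - 1 - (Y.take i.val).count false =
      ((Y.take i.val).length - (Y.take i.val).count false) + (Y.drop (i.val + 1)).length := by
    simp only [List.length_drop, List.length_take] at hc ⊢; omega
  rw [e, wordWeight_eq, pow_add, fillSum]
  split_ifs
  · ring
  · rfl

lemma occSum_fillSum_wAux (q u : P6) (t : Bool) (r : P6) (Y : List Bool) :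
    occSum q u t r (fillSum (wAux Y.length)) Y = occSum q u t r (fillSum w) Y := by
  refine occSum_congr _ _ _ _ _ fun U V hUV => ?_
  have hl : ∀ x, (U ++ x :: V).length = Y.length := by intro x; simp; omega
  simp only [fillSum, w, hl]

lemma wordRec_w : WordRec (X 0 : P6) (X 1) (X 2) (X 3) (X 4) (X 5) w where
  black Y := by
    rw [← occSum_fillSum_wAux, ← occSum_fillSum_wAux, ← sumBlackP_eq_occSum,
      ← sumWhiteP_eq_occSum, wordWeight_eq]
    simp [w, wAux]
  white Y := by
    rw [← occSum_fillSum_wAux, ← occSum_fillSum_wAux, ← sumBlackP_eq_occSum,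
      ← sumWhiteP_eq_occSum, wordWeight_eq]
    simp [w, wAux]

/-- the composition of `w` with the canonical embedding of `ℚ[α,β,γ,δ,q,u]`
into `K = ℚ(α,β,γ,δ,q,u)` is a solution of the matrix ansatz system for `lamStd`. -/
theorem statement4 : IsSolution lamStd (fun m => algebraMap P6 K6 (w m)) := by
  have hX : ∀ i : Fin 6, (X i : P6) ≠ 0 := fun i => X_ne_zero i
  have hE := wordRec_w.exchangeAt (hX 0) (hX 4) (hX 5)
  refine ⟨fun Xl Yl => ?_, fun Xl => ?_, fun Xl => ?_, ?_⟩
  · have h := hE (Xl.length + Yl.length + 1) Xl Yl rfl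
    simp only [vu, vq, lamStd, ← map_mul, ← map_add]
    exact congrArg _ h
  · have h := wordRec_w.left_boundary Xl
    simp only [va, vg, lamStd, ← map_mul, ← map_add]
    exact congrArg _ h
  · have h := wordRec_w.right_boundary (hX 4) (hX 5) Xl (hE Xl.length)
    simp only [vb, vd, lamStd, ← map_mul, ← map_add]
    exact congrArg _ h
  · simp [w, wAux, lamStd]
end
end

section
/- For every n ≥ 0, substituting β = 0 and γ = 0 in the generating polynomial Z_n(α,β,γ,δ;q,u) of staircase tableaux of size n yields the polynomial ∏_{i=0}^{n−1} ( u^i·α + α·δ·(Σ_{j=0}^{i−1} u^{i−1−j}·q^j) + q^i·δ ). -/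
open MvPolynomial Finset

noncomputable section

/-- A staircase tableau of size `n` is an assignment, to each cell `(i,j)` with `j ≤ i`
(indices `0`-based here, rows numbered bottom to top, columns left to right), of either the
empty label (`none`) or one of the four symbols `α,β,γ,δ` (`some 0, some 1, some 2, some 3`),
such that every diagonal cell is non-empty, the cells above an `α/γ` in its column are empty,
and the cells to the left of a `β/δ` in its row are empty.  Cells outside the staircase
(`i < j`) carry `none`. -/
def IsStaircase (n : ℕ) (T : Fin n → Fin n → Option (Fin 4)) : Prop :=
  (∀ i j : Fin n, i < j → T i j = none) ∧
  (∀ i : Fin n, T i i ≠ none) ∧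
  (∀ i j i' : Fin n, j ≤ i → i < i' → (T i j = some 0 ∨ T i j = some 2) → T i' j = none) ∧
  (∀ i j j' : Fin n, j' < j → j ≤ i → (T i j = some 1 ∨ T i j = some 3) → T i j' = none)

instance IsStaircase.decPred (n : ℕ) : DecidablePred (IsStaircase n) := fun _ =>
  @instDecidableAnd _ _ inferInstance
    (@instDecidableAnd _ _ inferInstance (@instDecidableAnd _ _ inferInstance inferInstance))

/-- The type of staircase tableaux of size `n`. -/
def StaircaseTableau (n : ℕ) : Type := {T : Fin n → Fin n → Option (Fin 4) // IsStaircase n T}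

instance (n : ℕ) : Fintype (StaircaseTableau n) := Subtype.fintype _

/-- The label of the nearest non-empty cell to the right of the cell `(i,j)` in its row
(`none` if there is no such cell). -/
def nearestRight (n : ℕ) (T : Fin n → Fin n → Option (Fin 4)) (i j : Fin n) :
    Option (Fin 4) :=
  if h : (univ.filter fun j' : Fin n => j < j' ∧ T i j' ≠ none).Nonempty then
    T i ((univ.filter fun j' : Fin n => j < j' ∧ T i j' ≠ none).min' h)
  else none

/-- The label of the nearest non-empty cell below the cell `(i,j)` in its column
(`none` if there is no such cell). -/
def nearestBelow (n : ℕ) (T : Fin n → Fin n → Option (Fin 4)) (i j : Fin n) :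
    Option (Fin 4) :=
  if h : (univ.filter fun i' : Fin n => i' < i ∧ T i' j ≠ none).Nonempty then
    T ((univ.filter fun i' : Fin n => i' < i ∧ T i' j ≠ none).max' h) j
  else none

/-- The condition for an empty cell to receive a `q` in the `q/u` filling: the nearest
non-empty cell to its right contains a `δ`, or the nearest non-empty cell to its right
contains an `α` or a `γ` and the nearest non-empty cell below it contains a `β` or a `γ`. -/
def QCell (n : ℕ) (T : Fin n → Fin n → Option (Fin 4)) (i j : Fin n) : Prop :=
  nearestRight n T i j = some 3 ∨
    ((nearestRight n T i j = some 0 ∨ nearestRight n T i j = some 2) ∧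
      (nearestBelow n T i j = some 1 ∨ nearestBelow n T i j = some 2))

instance (n : ℕ) (T : Fin n → Fin n → Option (Fin 4)) (i j : Fin n) :
    Decidable (QCell n T i j) := by
  unfold QCell; infer_instance

/-- The entry of the cell `(i,j)` after the `q/u` filling, as a monomial of
`ℚ[α,β,γ,δ,q,u]`: a labelled cell contributes its symbol, an empty cell contributes `q` or
`u` according to the filling rule. -/
def cellValue (n : ℕ) (T : Fin n → Fin n → Option (Fin 4)) (i j : Fin n) : P6 :=
  match T i j with
  | some s => X (Fin.castLE (by omega) s)
  | none => if QCell n T i j then X 4 else X 5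

/-- The weight `w(T) ∈ ℚ[α,β,γ,δ,q,u]` of a staircase tableau: the product of the entries of
all its cells after the `q/u` filling. -/
def wt {n : ℕ} (T : StaircaseTableau n) : P6 :=
  ∏ i : Fin n, ∏ j : Fin n, if j ≤ i then cellValue n T.1 i j else 1

/-- The type of a staircase tableau of size `n`: the word `m_n ⋯ m_1` (leftmost letter first)
with `m_i = •` (`true`) if the `i`-th diagonal cell contains `α` or `δ` and `m_i = ∘`
(`false`) if it contains `β` or `γ`. -/
def typeOf {n : ℕ} (T : StaircaseTableau n) : List Bool :=
  List.ofFn fun k : Fin n =>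
    decide (T.1 k.rev k.rev = some 0 ∨ T.1 k.rev k.rev = some 3)

/-- The generating polynomial `Z_n(α,β,γ,δ;q,u)` of staircase tableaux of size `n`. -/
def Zst (n : ℕ) : P6 := ∑ T : StaircaseTableau n, wt T

/-- The substitution `β = 0`, `γ = 0` (variables `1` and `2` are sent to `0`, the others are
kept). -/
def subBG : P6 →ₐ[ℚ] P6 := aeval (fun i : Fin 6 => if i.val = 1 ∨ i.val = 2 then 0 else X i)


section AlphaDelta

/-- The leftmost non-empty label of the row `r` is a `δ`. -/
def LeadsDelta {n : ℕ} (r : Fin n → Option (Fin 4)) : Prop :=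
  ∃ j, r j = some 3 ∧ ∀ k < j, r k = none

/-- The nearest non-empty label to the right of position `j` in the row `r` is a `δ`. -/
def RightDelta {n : ℕ} (r : Fin n → Option (Fin 4)) (j : Fin n) : Prop :=
  ∃ j', j < j' ∧ r j' = some 3 ∧ ∀ k, j < k → k < j' → r k = none

/-- The staircase conditions, keeping only the constraints imposed by `α` and `δ`. -/
def IsAlphaDelta (n : ℕ) (T : Fin n → Fin n → Option (Fin 4)) : Prop :=
  (∀ i j, i < j → T i j = none) ∧
  (∀ i, T i i ≠ none) ∧
  (∀ i j i', i < i' → T i j = some 0 → T i' j = none) ∧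
  (∀ i j j', j' < j → T i j = some 3 → T i j' = none)

/-- The condition for a column `c` to be placed to the left of rows, those satisfying `l` being
led by a `δ`, below an additional `δ`. -/
def IsColumn {n : ℕ} (l : Fin n → Prop) (c : Fin n → Option (Fin 4)) : Prop :=
  (∀ i i', i < i' → c i = some 0 → c i' = none) ∧ ∀ i, l i → c i = none

variable {R : Type*} [CommRing R] (a d q u : R)

open Classical in
/-- The value of a cell labelled `x` after the substitution `β = γ = 0`, where `p` says that the
nearest label to its right is a `δ`. -/
def cellWeight (p : Prop) (x : Option (Fin 4)) : R :=
  if x = none then if p then q else u else if x = some 0 then a else if x = some 3 then d else 0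

open Classical in
/-- The marker of a row: `s` if its leftmost label is a `δ`, and `t` otherwise. -/
def rowMark (t s : R) {n : ℕ} (r : Fin n → Option (Fin 4)) : R := if LeadsDelta r then s else t

open Classical in
/-- The contribution of a new leftmost cell, including the marker of the extended row. -/
def markedWeight (t s : R) (p : Prop) (x : Option (Fin 4)) : R :=
  if x = none then if p then q * s else u * t
  else if x = some 0 then a * t else if x = some 3 then d * s else 0

/-- The weight of the part of row `i` weakly below the diagonal. -/
def rowWeight {n : ℕ} (T : Fin n → Fin n → Option (Fin 4)) (i : Fin n) : R :=
  ∏ j, if j ≤ i then cellWeight a d q u (RightDelta (T i) j) (T i j) else 1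

open Classical in
/-- The generating function of `α/δ`-tableaux with marked rows. -/
def markedSum (n : ℕ) (t s : R) : R :=
  ∑ T : Fin n → Fin n → Option (Fin 4),
    if IsAlphaDelta n T then ∏ i, rowWeight a d q u T i * rowMark t s (T i) else 0

theorem leadsDelta_cons {n : ℕ} (x : Option (Fin 4)) (r : Fin n → Option (Fin 4)) :
    LeadsDelta (Fin.cons x r : Fin (n + 1) → Option (Fin 4)) ↔
      x = some 3 ∨ (x = none ∧ LeadsDelta r) := by
  simp only [LeadsDelta, Fin.exists_fin_succ, Fin.forall_fin_succ, Fin.cons_zero, Fin.cons_succ,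
    Fin.succ_lt_succ_iff, Fin.succ_pos, Fin.not_lt_zero, forall_const, IsEmpty.forall_iff]
  grind

theorem rightDelta_cons_zero {n : ℕ} (x : Option (Fin 4)) (r : Fin n → Option (Fin 4)) :
    RightDelta (Fin.cons x r : Fin (n + 1) → Option (Fin 4)) 0 ↔ LeadsDelta r := by
  simp [LeadsDelta, RightDelta, Fin.exists_fin_succ, Fin.forall_fin_succ]

theorem rightDelta_cons_succ {n : ℕ} (x : Option (Fin 4)) (r : Fin n → Option (Fin 4))
    (j : Fin n) :
    RightDelta (Fin.cons x r : Fin (n + 1) → Option (Fin 4)) j.succ ↔ RightDelta r j := by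
  simp [RightDelta, Fin.exists_fin_succ, Fin.forall_fin_succ]

theorem cellWeight_mul_rowMark (t s : R) {n : ℕ} (x : Option (Fin 4))
    (r : Fin n → Option (Fin 4)) :
    cellWeight a d q u (LeadsDelta r) x *
        rowMark t s (Fin.cons x r : Fin (n + 1) → Option (Fin 4)) =
      markedWeight a d q u t s (LeadsDelta r) x := by
  classical
  rw [rowMark, if_congr (leadsDelta_cons x r) rfl rfl, cellWeight, markedWeight]
  by_cases h : LeadsDelta r <;> rcases x with _ | x <;> [skip; fin_cases x; skip; fin_cases x] <;>
    simp [h]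

theorem isColumn_cons {n : ℕ} (l : Fin (n + 1) → Prop) (x : Option (Fin 4))
    (c : Fin n → Option (Fin 4)) :
    IsColumn l (Fin.cons x c : Fin (n + 1) → Option (Fin 4)) ↔
      (x = some 0 → c = fun _ => none) ∧ (l 0 → x = none) ∧
        IsColumn (fun i => l i.succ) c := by
  simp [IsColumn, Fin.forall_fin_succ, funext_iff]
  grind

theorem isColumn_none {n : ℕ} (l : Fin n → Prop) : IsColumn l fun _ => none := by
  simp [IsColumn]

theorem sum_fin_cons {L : Type*} [Fintype L] {n : ℕ} (f : (Fin (n + 1) → L) → R) :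
    ∑ c, f c = ∑ x, ∑ c, f (Fin.cons x c) := by
  rw [← (Fin.consEquiv fun _ => L).sum_comp, Fintype.sum_prod_type]
  rfl

open Classical in
/-- The sum over all columns below which there is a `δ`, combined with the empty column below
which there is an `α`. -/
theorem sum_isColumn (t s : R) {n : ℕ} (l : Fin n → Prop) :
    d * s * (∑ c : Fin n → Option (Fin 4),
        if IsColumn l c then ∏ i, markedWeight a d q u t s (l i) (c i) else 0) +
      a * t * ∏ i, markedWeight a d q u t s (l i) none =
    (a * t + d * s) * ∏ i, if l i then q * s else u * t + d * s := by
  induction n with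
  | zero => simp [IsColumn]; ring
  | succ n ih =>
    have key : ∀ x : Option (Fin 4), (∑ c : Fin n → Option (Fin 4),
        if IsColumn l (Fin.cons x c : Fin (n + 1) → Option (Fin 4)) then
          ∏ i, markedWeight a d q u t s (l i)
            ((Fin.cons x c : Fin (n + 1) → Option (Fin 4)) i) else 0) =
        if l 0 → x = none then markedWeight a d q u t s (l 0) x *
          (if x = some 0 then ∏ i : Fin n, markedWeight a d q u t s (l i.succ) none else
            ∑ c : Fin n → Option (Fin 4), if IsColumn (fun i => l i.succ) c then
              ∏ i : Fin n, markedWeight a d q u t s (l i.succ) (c i) else 0) else 0 := by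
      intro x
      simp only [isColumn_cons, Fin.prod_univ_succ, Fin.cons_zero, Fin.cons_succ]
      by_cases h : l 0 → x = none
      · by_cases h0 : x = some 0
        · simp only [h0, forall_const, if_true]
          rw [Finset.sum_eq_single (fun _ => none)]
          · have := isColumn_none fun i => l (Fin.succ i)
            subst h0
            simp_all
          · intro c _ hc
            simp [hc]
          · simp
        · simp only [h0, eq_true h, true_and, if_true, if_false, Finset.mul_sum, mul_ite,
          mul_zero, false_imp_iff]
      · simp [h]
    simp only [sum_fin_cons, key]
    simp only [Fin.prod_univ_succ]
    specialize ih fun i => l i.succ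
    simp only [Fintype.sum_option, Fin.sum_univ_four]
    by_cases h : l 0
    · simp [h, markedWeight] at ih ⊢
      linear_combination (q * s) * ih
    · simp [h, markedWeight] at ih ⊢
      linear_combination (u * t + d * s) * ih

/-- Assembles a square array from its corner, the rest of its first row and column, and the
remaining square. -/
def arrayCons {L : Type*} {n : ℕ} (x : L) (r c : Fin n → L) (T : Fin n → Fin n → L) :
    Fin (n + 1) → Fin (n + 1) → L :=
  Fin.cons (Fin.cons x r : Fin (n + 1) → L) fun i => (Fin.cons (c i) (T i) : Fin (n + 1) → L)

/-- The decomposition of square arrays underlying `arrayCons`. -/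
def arrayConsEquiv (L : Type*) (n : ℕ) :
    (Fin n → Fin n → L) × (Fin n → L) × L × (Fin n → L) ≃ (Fin (n + 1) → Fin (n + 1) → L) where
  toFun p := arrayCons p.2.2.1 p.2.2.2 p.2.1 p.1
  invFun T := (fun i j => T i.succ j.succ, fun i => T i.succ 0, T 0 0, fun j => T 0 j.succ)
  left_inv _ := rfl
  right_inv T := by
    funext i j
    cases i using Fin.cases <;> cases j using Fin.cases <;> rfl

theorem sum_arrayCons {L : Type*} [Fintype L] {n : ℕ}
    (f : (Fin (n + 1) → Fin (n + 1) → L) → R) :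
    ∑ T, f T = ∑ T, ∑ c, ∑ x, ∑ r, f (arrayCons x r c T) := by
  simp only [← (arrayConsEquiv L n).sum_comp, Fintype.sum_prod_type]
  rfl

theorem isAlphaDelta_arrayCons {n : ℕ} (x : Option (Fin 4)) (r c : Fin n → Option (Fin 4))
    (T : Fin n → Fin n → Option (Fin 4)) :
    IsAlphaDelta (n + 1) (arrayCons x r c T) ↔
      IsAlphaDelta n T ∧ (r = fun _ => none) ∧ x ≠ none ∧ (x = some 0 → c = fun _ => none) ∧
        IsColumn (fun i => LeadsDelta (T i)) c := by
  simp only [IsAlphaDelta, arrayCons, IsColumn, LeadsDelta, Fin.forall_fin_succ, Fin.cons_zero,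
    Fin.cons_succ, Fin.succ_lt_succ_iff, Fin.succ_pos, Fin.not_lt_zero, forall_const,
    IsEmpty.forall_iff, funext_iff, lt_self_iff_false, true_and]
  constructor
  · grind
  · rintro ⟨⟨h1, h2, h3, h4⟩, hr, hx, h0, hc, hl⟩
    refine ⟨?_, ?_, ?_, ?_⟩ <;> grind

theorem rowWeight_arrayCons_zero {n : ℕ} (x : Option (Fin 4)) (r c : Fin n → Option (Fin 4))
    (T : Fin n → Fin n → Option (Fin 4)) :
    rowWeight a d q u (arrayCons x r c T) 0 = cellWeight a d q u (LeadsDelta r) x := by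
  simp [rowWeight, arrayCons, rightDelta_cons_zero]

theorem rowWeight_arrayCons_succ {n : ℕ} (x : Option (Fin 4)) (r c : Fin n → Option (Fin 4))
    (T : Fin n → Fin n → Option (Fin 4)) (i : Fin n) :
    rowWeight a d q u (arrayCons x r c T) i.succ =
      cellWeight a d q u (LeadsDelta (T i)) (c i) * rowWeight a d q u T i := by
  simp [rowWeight, Fin.prod_univ_succ, arrayCons, rightDelta_cons_zero, rightDelta_cons_succ]

theorem prod_rowWeight_arrayCons (t s : R) {n : ℕ} (x : Option (Fin 4))
    (r c : Fin n → Option (Fin 4)) (T : Fin n → Fin n → Option (Fin 4)) :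
    ∏ i, rowWeight a d q u (arrayCons x r c T) i * rowMark t s (arrayCons x r c T i) =
      markedWeight a d q u t s (LeadsDelta r) x *
        ((∏ i, markedWeight a d q u t s (LeadsDelta (T i)) (c i)) *
          ∏ i, rowWeight a d q u T i) := by
  rw [Fin.prod_univ_succ, rowWeight_arrayCons_zero, ← Finset.prod_mul_distrib]
  simp only [rowWeight_arrayCons_succ, ← cellWeight_mul_rowMark]
  congr 1
  exact Finset.prod_congr rfl fun i _ => by
    simp only [arrayCons, Fin.cons_succ]
    ring

theorem markedSum_succ (n : ℕ) (t s : R) :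
    markedSum a d q u (n + 1) t s =
      (a * t + d * s) * markedSum a d q u n (u * t + d * s) (q * s) := by
  classical
  simp only [markedSum]
  rw [sum_arrayCons, Finset.mul_sum]
  refine Finset.sum_congr rfl fun T _ => ?_
  simp only [isAlphaDelta_arrayCons, prod_rowWeight_arrayCons]
  by_cases hT : IsAlphaDelta n T
  swap
  · simp [hT]
  have hcol := sum_isColumn a d q u t s fun i => LeadsDelta (T i)
  have hnone := isColumn_none fun i => LeadsDelta (T i)
  have hzero : ∀ f : (Fin n → Option (Fin 4)) → R,
      (∑ c, if (c = fun _ => none) ∧ IsColumn (fun i => LeadsDelta (T i)) c then f c else 0) =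
        f fun _ => none := fun f => by
    simp only [ite_and, Finset.sum_ite_eq', Finset.mem_univ, if_true, hnone]
  simp only [hT, true_and, if_true, Finset.prod_mul_distrib, rowMark]
  rw [mul_left_comm, ← hcol]
  simp only [ite_and (_ = fun _ => none), Finset.sum_ite_eq', Finset.mem_univ, if_true,
    Fintype.sum_option, Fin.sum_univ_four]
  simp only [markedWeight.eq_def a d q u t s (LeadsDelta fun _ => none), Finset.sum_add_distrib]
  simp [hzero]
  have hW : ∀ (P : Prop) (A W : R), (if P then d * s * (A * W) else 0) =
      W * (d * s * if P then A else 0) := fun P A W => by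
    split_ifs <;> ring
  simp only [hW, ← Finset.mul_sum]
  ring

theorem markedSum_eq_prod (n : ℕ) (t s : R) :
    markedSum a d q u n t s = ∏ i ∈ Finset.range n,
      (u ^ i * a * t + a * d * s * ∑ j ∈ Finset.range i, u ^ (i - 1 - j) * q ^ j +
        q ^ i * d * s) := by
  induction n generalizing t s with
  | zero => simp [markedSum, IsAlphaDelta]
  | succ n ih =>
    rw [markedSum_succ, ih, Finset.prod_range_succ', mul_comm]
    congr 1
    · refine Finset.prod_congr rfl fun i _ => ?_
      have h : ∀ j ∈ Finset.range i, u ^ (i + 1 - 1 - (j + 1)) * q ^ (j + 1) =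
          q * (u ^ (i - 1 - j) * q ^ j) := fun j _ => by
        rw [show i + 1 - 1 - (j + 1) = i - 1 - j by omega]
        ring
      rw [Finset.sum_range_succ', Finset.sum_congr rfl h, ← Finset.mul_sum]
      simp only [Nat.add_sub_cancel, Nat.sub_zero, pow_zero]
      ring
    · simp

end AlphaDelta

theorem nearestRight_eq_some_iff {n : ℕ} (T : Fin n → Fin n → Option (Fin 4)) (i j : Fin n) :
    nearestRight n T i j = some 3 ↔ RightDelta (T i) j := by
  unfold nearestRight
  split_ifs with h
  · have hm := Finset.min'_mem _ h
    have hle : ∀ k, j < k → T i k ≠ none → Finset.min' _ h ≤ k := fun k h1 h2 =>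
      Finset.min'_le _ k (by simp [h1, h2])
    generalize Finset.min' _ h = m at *
    simp only [Finset.mem_filter, Finset.mem_univ, true_and] at hm
    constructor
    · intro h3
      exact ⟨m, hm.1, h3, fun k h1 h2 => by_contra fun h4 => (hle k h1 h4).not_gt h2⟩
    · rintro ⟨j', h1, h2, h3⟩
      rcases (hle j' h1 (by simp [h2])).eq_or_lt with rfl | hlt
      · exact h2
      · exact absurd (h3 m hm.1 hlt) hm.2
  · simp only [false_iff]
    rintro ⟨j', h1, h2, -⟩
    exact h ⟨j', by simp [h1, h2]⟩

theorem nearestBelow_eq_none_or {n : ℕ} (T : Fin n → Fin n → Option (Fin 4)) (i j : Fin n) :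
    nearestBelow n T i j = none ∨ ∃ i', nearestBelow n T i j = T i' j := by
  unfold nearestBelow
  split_ifs with h
  · exact Or.inr ⟨_, rfl⟩
  · exact Or.inl rfl

theorem qCell_iff {n : ℕ} {T : Fin n → Fin n → Option (Fin 4)}
    (hT : ∀ i j, T i j ≠ some 1 ∧ T i j ≠ some 2) (i j : Fin n) :
    QCell n T i j ↔ RightDelta (T i) j := by
  rw [QCell, nearestRight_eq_some_iff]
  have : ¬ (nearestBelow n T i j = some 1 ∨ nearestBelow n T i j = some 2) := by
    rcases nearestBelow_eq_none_or T i j with h | ⟨i', h⟩ <;> simp [h, hT]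
  tauto

theorem subBG_cellValue_eq_zero {n : ℕ} {T : Fin n → Fin n → Option (Fin 4)} {i j : Fin n}
    (h : T i j = some 1 ∨ T i j = some 2) : subBG (cellValue n T i j) = 0 := by
  rcases h with h | h <;> simp [cellValue, h, subBG]

theorem subBG_cellValue {n : ℕ} {T : Fin n → Fin n → Option (Fin 4)}
    (hT : ∀ i j, T i j ≠ some 1 ∧ T i j ≠ some 2) (i j : Fin n) :
    subBG (cellValue n T i j) =
      cellWeight (X 0 : P6) (X 3) (X 4) (X 5) (RightDelta (T i) j) (T i j) := by
  have hq := qCell_iff hT i j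
  obtain ⟨h1, h2⟩ := hT i j
  rcases h : T i j with _ | x
  · by_cases hr : RightDelta (T i) j <;> simp [cellValue, cellWeight, h, hq, hr, subBG]
  · rw [h] at h1 h2
    fin_cases x <;> simp_all [cellValue, cellWeight, subBG]

theorem isStaircase_iff {n : ℕ} {T : Fin n → Fin n → Option (Fin 4)}
    (hT : ∀ i j, T i j ≠ some 1 ∧ T i j ≠ some 2) : IsStaircase n T ↔ IsAlphaDelta n T := by
  unfold IsStaircase IsAlphaDelta
  refine and_congr_right fun h => and_congr_right fun _ => ?_
  have hle : ∀ i j, T i j ≠ none → j ≤ i := fun i j hij => not_lt.1 fun hlt => hij (h i j hlt)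
  refine and_congr ?_ ?_ <;> grind

theorem subBG_Zst (n : ℕ) :
    subBG (Zst n) = markedSum (X 0 : P6) (X 3) (X 4) (X 5) n 1 1 := by
  classical
  have hZ : Zst n = ∑ T : Fin n → Fin n → Option (Fin 4), if IsStaircase n T then
      ∏ i, ∏ j, (if j ≤ i then cellValue n T i j else 1) else 0 := by
    rw [← Finset.sum_filter]
    exact (Finset.sum_subtype (univ.filter (IsStaircase n)) (fun _ => by simp)
      fun T => ∏ i, ∏ j, if j ≤ i then cellValue n T i j else 1).symm
  rw [hZ, markedSum, map_sum]
  refine Finset.sum_congr rfl fun T _ => ?_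
  simp only [rowMark, ite_self, mul_one, apply_ite subBG, map_prod, map_zero, map_one]
  by_cases hT : ∀ i j, T i j ≠ some 1 ∧ T i j ≠ some 2
  · simp only [isStaircase_iff hT, subBG_cellValue hT, rowWeight]
  · simp only [not_forall, not_and_or, not_not] at hT
    obtain ⟨i, j, hij⟩ := hT
    trans 0
    · split_ifs with h
      · have hle : j ≤ i := not_lt.1 fun hlt => by simp [h.1 i j hlt] at hij
        exact Finset.prod_eq_zero (Finset.mem_univ i) <|
          Finset.prod_eq_zero (Finset.mem_univ j) <| by simp [hle, subBG_cellValue_eq_zero hij]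
      · rfl
    · split_ifs with h
      · have hle : j ≤ i := not_lt.1 fun hlt => by simp [h.1 i j hlt] at hij
        exact (Finset.prod_eq_zero (Finset.mem_univ i) <|
          Finset.prod_eq_zero (Finset.mem_univ j) <| by
            rcases hij with hij | hij <;> simp [hle, cellWeight, hij]).symm
      · rfl

/-- substituting `β = 0`, `γ = 0` in the generating polynomial
`Z_n(α,β,γ,δ;q,u)` of staircase tableaux of size `n` yields
`∏_{i=0}^{n−1} (u^i α + αδ(u^{i−1} + u^{i−2}q + ⋯ + q^{i−1}) + q^i δ)`. -/
theorem statement11 (n : ℕ) :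
    subBG (Zst n) =
      ∏ i ∈ Finset.range n,
        ((X 5 : P6) ^ i * X 0 +
          X 0 * X 3 * ∑ j ∈ Finset.range i, (X 5 : P6) ^ (i - 1 - j) * (X 4 : P6) ^ j +
          (X 4 : P6) ^ i * X 3) := by
  simpa using (subBG_Zst n).trans (markedSum_eq_prod _ _ _ _ n 1 1)
end
end
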